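/- Let (X, ‖·‖) be a normed vector space, ρ > 0, L > 0, and n ≥ 1. Let B_L be the class of L-Lipschitz functions f : X → [−1,1], and fix a sample S = ((x_1,y_1),…,(x_n,y_n)) with x_i ∈ X and y_i ∈ [−1,1]. Define the squared loss vectors ℓ ∘ B_L ∘ S = {((f(x_i) − y_i)²)_{i=1}^n : f ∈ B_L} and the robust squared loss vectors ℓ_ρ ∘ B_L ∘ S = {(sup_{‖δ‖ ≤ ρ}(f(x_i + δ) − y_i)²)_{i=1}^n : f ∈ B_L}. Then Rad(ℓ_ρ ∘ B_L ∘ S) ≤ 2 · Rad(ℓ ∘ B_L ∘ S). -/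

import Mathlib

/-- Empirical Rademacher complexity of a set of vectors `A ⊆ ℝⁿ`:
the expectation, over i.i.d. uniform signs σ ∈ {−1,+1}ⁿ, of
`sup_{a ∈ A} (1/n) ∑ i, σ i * a i`. -/
noncomputable def rad {n : ℕ} (A : Set (Fin n → ℝ)) : ℝ :=
  ((2 : ℝ) ^ n)⁻¹ * ∑ σ : Fin n → Bool,
    sSup ((fun a : Fin n → ℝ =>
      (n : ℝ)⁻¹ * ∑ i, (if σ i then (1 : ℝ) else -1) * a i) '' A)

/-- The class of L-Lipschitz functions X → [−1,1]. -/
def lipClass (X : Type*) [NormedAddCommGroup X] [NormedSpace ℝ X] (L : ℝ) :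
    Set (X → ℝ) :=
  {f | (∀ x x' : X, |f x - f x'| ≤ L * ‖x - x'‖) ∧ ∀ x, f x ∈ Set.Icc (-1 : ℝ) 1}

/-- The sum over all sign vectors `σ` of `sup_t ∑ i, σ i * u t i`, for an indexed family `u` of
vectors. Up to normalization this is the Rademacher complexity of the range of `u`. -/
noncomputable def signSupSum {ι : Type*} {n : ℕ} (u : ι → Fin n → ℝ) : ℝ :=
  ∑ σ : Fin n → Bool, ⨆ t, ∑ i, (if σ i then (1 : ℝ) else -1) * u t i

theorem rad_range {ι : Type*} {n : ℕ} (u : ι → Fin n → ℝ) :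
    rad (Set.range u) = ((2 : ℝ) ^ n)⁻¹ * ((n : ℝ)⁻¹ * signSupSum u) := by
  unfold rad signSupSum
  rw [Finset.mul_sum Finset.univ _ (n : ℝ)⁻¹]
  congr 1
  refine Finset.sum_congr rfl fun σ _ => ?_
  rw [Real.mul_iSup_of_nonneg (by positivity), ← Set.range_comp]
  rfl

theorem bddAbove_range_sum_sign_mul {ι : Type*} {n : ℕ} {u : ι → Fin n → ℝ} {C : ℝ}
    (hu : ∀ t i, |u t i| ≤ C) (σ : Fin n → Bool) :
    BddAbove (Set.range fun t => ∑ i, (if σ i then (1 : ℝ) else -1) * u t i) := by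
  refine ⟨∑ _i : Fin n, C, ?_⟩
  rintro _ ⟨t, rfl⟩
  refine Finset.sum_le_sum fun i _ => ?_
  have := abs_le.1 (hu t i)
  split_ifs <;> linarith

/-- Reindexing a family can only decrease its sign-supremum sum. -/
theorem signSupSum_comp_le {ι κ : Type*} [Nonempty κ] {n : ℕ} {u : ι → Fin n → ℝ} {C : ℝ}
    (hu : ∀ t i, |u t i| ≤ C) (g : κ → ι) :
    signSupSum (fun t => u (g t)) ≤ signSupSum u :=
  Finset.sum_le_sum fun σ _ =>
    ciSup_le fun t => le_ciSup (bddAbove_range_sum_sign_mul hu σ) (g t)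

theorem signSupSum_add_le {ι : Type*} [Nonempty ι] {n : ℕ} {u v : ι → Fin n → ℝ} {C D : ℝ}
    (hu : ∀ t i, |u t i| ≤ C) (hv : ∀ t i, |v t i| ≤ D) :
    signSupSum (fun t i => u t i + v t i) ≤ signSupSum u + signSupSum v := by
  unfold signSupSum
  rw [← Finset.sum_add_distrib]
  refine Finset.sum_le_sum fun σ _ => ciSup_le fun t => ?_
  simp only [mul_add, Finset.sum_add_distrib]
  exact add_le_add (le_ciSup (bddAbove_range_sum_sign_mul hu σ) t)
    (le_ciSup (bddAbove_range_sum_sign_mul hv σ) t)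

theorem signSupSum_const_mul {ι : Type*} {n : ℕ} (u : ι → Fin n → ℝ) {c : ℝ} (hc : 0 ≤ c) :
    signSupSum (fun t i => c * u t i) = c * signSupSum u := by
  unfold signSupSum
  simp only [Finset.mul_sum, Real.mul_iSup_of_nonneg hc, mul_left_comm c]

theorem signSupSum_neg {ι : Type*} {n : ℕ} (u : ι → Fin n → ℝ) :
    signSupSum (fun t i => -u t i) = signSupSum u := by
  have hinv : Function.Involutive fun (σ : Fin n → Bool) i => !σ i := fun σ => by simp
  unfold signSupSum
  rw [← Equiv.sum_comp hinv.toPerm]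
  refine Finset.sum_congr rfl fun σ _ => iSup_congr fun t => Finset.sum_congr rfl fun i _ => ?_
  cases h : σ i <;> simp [Function.Involutive.toPerm, h]

/-- Replacing the `j`-th coordinate of a family by its absolute value can only decrease the
sign-supremum sum. -/
theorem signSupSum_update_abs_le {ι : Type*} [Nonempty ι] {n : ℕ} {u : ι → Fin n → ℝ} {C : ℝ}
    (hu : ∀ t i, |u t i| ≤ C) (j : Fin n) :
    signSupSum (fun t => Function.update (u t) j |u t j|) ≤ signSupSum u := by
  have hinv : Function.Involutive fun σ : Fin n → Bool => Function.update σ j (!σ j) :=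
    fun σ => by simp
  set flip := hinv.toPerm
  have hflip_apply : ∀ σ, flip σ = Function.update σ j (!σ j) := fun σ => rfl
  unfold signSupSum
  set F : (Fin n → Bool) → ℝ := fun σ =>
    ⨆ t, ∑ i, (if σ i then (1 : ℝ) else -1) * Function.update (u t) j |u t j| i with hF
  set G : (Fin n → Bool) → ℝ := fun σ =>
    ⨆ t, ∑ i, (if σ i then (1 : ℝ) else -1) * u t i
  have pair : ∀ σ, F σ + F (flip σ) ≤ G σ + G (flip σ) := by
    intro σ
    let R : ι → ℝ := fun t => ∑ i ∈ Finset.univ.erase j, (if σ i then (1 : ℝ) else -1) * u t i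
    let s : ℝ := if σ j then 1 else -1
    have hs : s = 1 ∨ s = -1 := by
      by_cases h : σ j <;> simp [s, h]
    have hG1 : ∀ t, s * u t j + R t ≤ G σ := fun t =>
      (Finset.add_sum_erase _ _ (Finset.mem_univ j)).le.trans
        (le_ciSup (bddAbove_range_sum_sign_mul hu σ) t)
    have hG2 : ∀ t, -s * u t j + R t ≤ G (flip σ) := by
      intro t
      refine le_trans (le_of_eq ?_) (le_ciSup (bddAbove_range_sum_sign_mul hu (flip σ)) t)
      rw [← Finset.add_sum_erase _ _ (Finset.mem_univ j)]
      congr 1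
      · cases h : σ j <;> simp [s, hflip_apply, h]
      · refine Finset.sum_congr rfl fun i hi => ?_
        rw [hflip_apply, Function.update_of_ne (Finset.ne_of_mem_erase hi)]
    have hF1 : ∀ t, ∑ i, (if σ i then (1 : ℝ) else -1) * Function.update (u t) j |u t j| i
        = s * |u t j| + R t := by
      intro t
      rw [← Finset.add_sum_erase _ _ (Finset.mem_univ j), Function.update_self]
      congr 1
      refine Finset.sum_congr rfl fun i hi => ?_
      rw [Function.update_of_ne (Finset.ne_of_mem_erase hi)]
    have hF2 : ∀ t, ∑ i, (if flip σ i then (1 : ℝ) else -1) *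
        Function.update (u t) j |u t j| i = -s * |u t j| + R t := by
      intro t
      rw [← Finset.add_sum_erase _ _ (Finset.mem_univ j), Function.update_self]
      congr 1
      · cases h : σ j <;> simp [s, hflip_apply, h]
      · refine Finset.sum_congr rfl fun i hi => ?_
        rw [hflip_apply, Function.update_of_ne (Finset.ne_of_mem_erase hi),
          Function.update_of_ne (Finset.ne_of_mem_erase hi)]
    simp only [hF, hF1, hF2]
    refine ciSup_add_ciSup_le fun t t' => ?_
    have h1 := hG1 t
    have h2 := hG2 t
    have h1' := hG1 t'
    have h2' := hG2 t'
    rcases hs with hs | hs <;> rw [hs] at h1 h2 h1' h2' ⊢ <;>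
      rcases abs_cases (u t j) with ⟨h, _⟩ | ⟨h, _⟩ <;>
      rcases abs_cases (u t' j) with ⟨h', _⟩ | ⟨h', _⟩ <;> rw [h, h'] <;> linarith
  have key : ∑ σ, (F σ + F (flip σ)) ≤ ∑ σ, (G σ + G (flip σ)) :=
    Finset.sum_le_sum fun σ _ => pair σ
  rw [Finset.sum_add_distrib, Finset.sum_add_distrib, Equiv.sum_comp flip F,
    Equiv.sum_comp flip G] at key
  linarith

/-- The contraction principle for the absolute value. -/
theorem signSupSum_abs_le {ι : Type*} [Nonempty ι] {n : ℕ} {u : ι → Fin n → ℝ} {C : ℝ}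
    (hu : ∀ t i, |u t i| ≤ C) :
    signSupSum (fun t i => |u t i|) ≤ signSupSum u := by
  suffices h : ∀ S : Finset (Fin n),
      signSupSum (fun t i => if i ∈ S then |u t i| else u t i) ≤ signSupSum u by
    simpa using h Finset.univ
  intro S
  induction S using Finset.induction_on with
  | empty => simp
  | insert j S hj ih =>
    refine le_trans (le_of_eq ?_) ((signSupSum_update_abs_le (C := C) (fun t i => ?_) j).trans ih)
    · congr 1
      funext t i
      rcases eq_or_ne i j with rfl | hij
      · simp [hj]
      · simp [hij]
    · split_ifs
      · simpa using hu t i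
      · exact hu t i

theorem signSupSum_max_le {ι : Type*} [Nonempty ι] {n : ℕ} {u v : ι → Fin n → ℝ} {C D : ℝ}
    (hu : ∀ t i, |u t i| ≤ C) (hv : ∀ t i, |v t i| ≤ D) :
    signSupSum (fun t i => max (u t i) (v t i)) ≤ signSupSum u + signSupSum v := by
  have hv' : ∀ t i, |-v t i| ≤ D := fun t i => by simpa using hv t i
  have hadd : ∀ t i, |u t i + v t i| ≤ C + D := fun t i =>
    (abs_add_le _ _).trans (add_le_add (hu t i) (hv t i))
  have hsub : ∀ t i, |u t i + -v t i| ≤ C + D := fun t i =>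
    (abs_add_le _ _).trans (add_le_add (hu t i) (hv' t i))
  have hmax : (fun t i => max (u t i) (v t i)) =
      fun t i => (1 / 2 : ℝ) * ((u t i + v t i) + |u t i + -v t i|) := by
    funext t i
    rw [← sub_eq_add_neg]
    rcases le_total (u t i) (v t i) with h | h
    · rw [max_eq_right h, abs_of_nonpos (by linarith)]; ring
    · rw [max_eq_left h, abs_of_nonneg (by linarith)]; ring
  rw [hmax, signSupSum_const_mul _ (by norm_num)]
  have h1 := signSupSum_add_le hadd (v := fun t i => |u t i + -v t i|)
    (D := C + D) (fun t i => by simpa only [abs_abs] using hsub t i)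
  have h2 := signSupSum_add_le hu hv
  have h3 := signSupSum_abs_le hsub
  have h4 := signSupSum_add_le hu hv'
  rw [signSupSum_neg] at h4
  linarith

section BallSup

variable {X : Type*} [NormedAddCommGroup X]

/-- The supremum of `f` over the closed ball of radius `ρ` around `x`. -/
noncomputable def ballSup (ρ : ℝ) (f : X → ℝ) (x : X) : ℝ :=
  ⨆ δ : {δ : X // ‖δ‖ ≤ ρ}, f (x + δ)

theorem ballSup_le {ρ : ℝ} (hρ : 0 ≤ ρ) {f : X → ℝ} {x : X} {c : ℝ}
    (h : ∀ δ : X, ‖δ‖ ≤ ρ → f (x + δ) ≤ c) : ballSup ρ f x ≤ c := by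
  have : Nonempty {δ : X // ‖δ‖ ≤ ρ} := ⟨⟨0, by simpa using hρ⟩⟩
  exact ciSup_le fun δ => h δ δ.2

variable [NormedSpace ℝ X]

theorem neg_mem_lipClass {L : ℝ} {f : X → ℝ} (hf : f ∈ lipClass X L) :
    (fun x => -f x) ∈ lipClass X L := by
  refine ⟨fun x x' => ?_, fun x => ?_⟩
  · rw [← abs_neg]
    convert hf.1 x x' using 2
    ring
  · have := hf.2 x
    exact ⟨by linarith [this.2], by linarith [this.1]⟩

theorem le_ballSup {ρ L : ℝ} {f : X → ℝ} (hf : f ∈ lipClass X L) (x : X) {δ : X}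
    (hδ : ‖δ‖ ≤ ρ) : f (x + δ) ≤ ballSup ρ f x := by
  have hb : BddAbove (Set.range fun δ : {δ : X // ‖δ‖ ≤ ρ} => f (x + δ)) :=
    ⟨1, by rintro _ ⟨δ, rfl⟩; exact (hf.2 _).2⟩
  exact le_ciSup hb ⟨δ, hδ⟩

theorem ballSup_mem_lipClass {ρ L : ℝ} (hρ : 0 ≤ ρ) {f : X → ℝ} (hf : f ∈ lipClass X L) :
    ballSup ρ f ∈ lipClass X L := by
  have hle : ∀ x x', ballSup ρ f x ≤ ballSup ρ f x' + L * ‖x - x'‖ := by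
    intro x x'
    refine ballSup_le hρ fun δ hδ => ?_
    have h1 := (abs_le.1 (hf.1 (x + δ) (x' + δ))).2
    rw [add_sub_add_right_eq_sub] at h1
    linarith [le_ballSup hf x' hδ]
  refine ⟨fun x x' => abs_le.2 ⟨?_, ?_⟩, fun x => ⟨?_, ?_⟩⟩
  · have := hle x' x
    rw [norm_sub_rev] at this
    linarith
  · linarith [hle x x']
  · exact (hf.2 (x + 0)).1.trans (le_ballSup hf x (by simpa using hρ))
  · exact ballSup_le hρ fun δ _ => (hf.2 _).2

/-- The robust squared loss is attained by the supremum or the infimum of `f` over the ball. -/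
theorem sSup_sq_sub_eq_max {ρ L : ℝ} (hρ : 0 ≤ ρ) {f : X → ℝ} (hf : f ∈ lipClass X L)
    (x : X) (y : ℝ) :
    sSup ((fun δ : X => (f (x + δ) - y) ^ 2) '' {δ | ‖δ‖ ≤ ρ}) =
      max ((ballSup ρ f x - y) ^ 2) ((-ballSup ρ (fun z => -f z) x - y) ^ 2) := by
  have h0 : ‖(0 : X)‖ ≤ ρ := by simpa using hρ
  have hf' := neg_mem_lipClass hf
  refine IsLUB.csSup_eq ⟨?_, ?_⟩ ⟨_, 0, h0, rfl⟩
  · rintro _ ⟨δ, hδ, rfl⟩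
    have h1 := le_ballSup hf x hδ
    have h2 := le_ballSup hf' x hδ
    rcases le_total y (f (x + δ)) with h | h
    · exact le_max_of_le_left (pow_le_pow_left₀ (by linarith) (by linarith) 2)
    · refine le_max_of_le_right ?_
      change (f (x + δ) - y) ^ 2 ≤ _
      nlinarith
  · intro M hM
    have hM' : ∀ δ : X, ‖δ‖ ≤ ρ → |f (x + δ) - y| ≤ √M := fun δ hδ =>
      Real.abs_le_sqrt (hM ⟨δ, hδ, rfl⟩)
    have hM0 : 0 ≤ M := (sq_nonneg _).trans (hM ⟨0, h0, rfl⟩)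
    have hz := abs_le.1 (hM' 0 h0)
    have h1 := le_ballSup hf x h0
    have h2 := le_ballSup hf' x h0
    have h3 : ballSup ρ f x ≤ y + √M := ballSup_le hρ fun δ hδ => by
      linarith [(abs_le.1 (hM' δ hδ)).2]
    have h4 : ballSup ρ (fun z => -f z) x ≤ √M - y := ballSup_le hρ fun δ hδ => by
      linarith [(abs_le.1 (hM' δ hδ)).1]
    refine max_le ?_ ?_ <;> rw [← Real.sq_sqrt hM0, sq_le_sq, abs_of_nonneg (Real.sqrt_nonneg M)] <;>
      refine abs_le.2 ⟨?_, ?_⟩ <;> linarith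

end BallSup

/-- the Rademacher complexity of the robust squared loss class is at
most twice that of the standard squared loss class. -/
theorem rad_robust_loss_le_two_rad_loss
    {X : Type*} [NormedAddCommGroup X] [NormedSpace ℝ X]
    (ρ L : ℝ) (hρ : 0 < ρ) (hL : 0 < L)
    {n : ℕ} (hn : 1 ≤ n) (x : Fin n → X) (y : Fin n → ℝ)
    (hy : ∀ i, y i ∈ Set.Icc (-1 : ℝ) 1) :
    rad {v : Fin n → ℝ | ∃ f ∈ lipClass X L, v = fun i =>
          sSup ((fun δ : X => (f (x i + δ) - y i) ^ 2) '' {δ | ‖δ‖ ≤ ρ})}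
      ≤ 2 * rad {v : Fin n → ℝ | ∃ f ∈ lipClass X L, v = fun i =>
          (f (x i) - y i) ^ 2} := by
  have : Nonempty (lipClass X L) :=
    ⟨⟨fun _ => 0, fun _ _ => by simpa using by positivity, fun _ => by norm_num⟩⟩
  let loss : lipClass X L → Fin n → ℝ := fun f i => (f.1 (x i) - y i) ^ 2
  let upper : lipClass X L → lipClass X L := fun f =>
    ⟨ballSup ρ f.1, ballSup_mem_lipClass hρ.le f.2⟩
  let lower : lipClass X L → lipClass X L := fun f =>
    ⟨fun z => -ballSup ρ (fun w => -f.1 w) z,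
      neg_mem_lipClass (ballSup_mem_lipClass hρ.le (neg_mem_lipClass f.2))⟩
  have hloss : ∀ f i, |loss f i| ≤ 4 := by
    intro f i
    obtain ⟨h1, h2⟩ := f.2.2 (x i)
    obtain ⟨h3, h4⟩ := hy i
    rw [abs_of_nonneg (sq_nonneg _)]
    change (f.1 (x i) - y i) ^ 2 ≤ 4
    nlinarith
  have hstd : {v : Fin n → ℝ | ∃ f ∈ lipClass X L, v = fun i => (f (x i) - y i) ^ 2} =
      Set.range loss := by
    ext v
    exact ⟨fun ⟨f, hf, hv⟩ => ⟨⟨f, hf⟩, hv.symm⟩, fun ⟨f, hv⟩ => ⟨f.1, f.2, hv.symm⟩⟩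
  have hrob : {v : Fin n → ℝ | ∃ f ∈ lipClass X L, v = fun i =>
      sSup ((fun δ : X => (f (x i + δ) - y i) ^ 2) '' {δ | ‖δ‖ ≤ ρ})} =
      Set.range fun f i => max (loss (upper f) i) (loss (lower f) i) := by
    have heq : ∀ f : lipClass X L, (fun i =>
        sSup ((fun δ : X => (f.1 (x i + δ) - y i) ^ 2) '' {δ | ‖δ‖ ≤ ρ})) =
        fun i => max (loss (upper f) i) (loss (lower f) i) := fun f =>
      funext fun i => sSup_sq_sub_eq_max hρ.le f.2 (x i) (y i)
    ext v
    exact ⟨fun ⟨f, hf, hv⟩ => ⟨⟨f, hf⟩, (hv.trans (heq ⟨f, hf⟩)).symm⟩,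
      fun ⟨f, hv⟩ => ⟨f.1, f.2, hv.symm.trans (heq f).symm⟩⟩
  rw [hstd, hrob, rad_range, rad_range]
  have hmax := signSupSum_max_le (fun f => hloss (upper f)) (fun f => hloss (lower f))
  have hu := signSupSum_comp_le hloss upper
  have hl := signSupSum_comp_le hloss lower
  calc _ ≤ ((2 : ℝ) ^ n)⁻¹ * ((n : ℝ)⁻¹ * (2 * signSupSum loss)) := by
        gcongr
        linarith
    _ = _ := by ring
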